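/- Consider the symmetric random walk on ℤ, i.e., the Markov chain F(x) = ½δ_{x−1} + ½δ_{x+1}, with Streett pair A = ℤ∖{0} and B = {0}. There is no lexicographic generalised Streett supermartingale for this Streett Markov chain: there exist no m ≥ 1 and function r : ℤ → [0,∞)^m such that for all x ≠ 0, ½ r(x−1) + ½ r(x+1) ≺ r(x), where ≺ denotes the strict lexicographic supermartingale ordering. -/

import Mathlib

open Set
open scoped ENNReal NNReal

/-- The strict lexicographic supermartingale ordering on `[0,∞]^m`:
`r ≻ r'` iff there is a level `l` with `r i ≥ r' i` for all `i < l` and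
`r l ≥ 1 + r' l`. -/
def lexGT {m : ℕ} (r r' : Fin m → ℝ≥0∞) : Prop :=
  ∃ l : Fin m, (∀ i < l, r' i ≤ r i) ∧ r' l + 1 ≤ r l


lemma aux_rw (f : ℕ → ℝ) (hf : ∀ n, 0 ≤ f n) (N : ℕ)
    (h : ∀ n, N ≤ n → f n + f (n+2) ≤ 2 * f (n+1)) :
    ∃ M, N ≤ M ∧ ∀ n, M ≤ n → ¬ (f n + f (n+2) + 2 ≤ 2 * f (n+1)) := by
  have anti : ∀ a, N ≤ a → ∀ k, f (a+k+1) - f (a+k) ≤ f (a+1) - f a := by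
    intro a ha k
    induction k with
    | zero => simp
    | succ k ih =>
      have := h (a+k) (by omega)
      have e : a + (k+1) + 1 = a + k + 2 := by ring
      have e' : a + (k+1) = a + k + 1 := by ring
      rw [e, e']
      linarith
  have nn : ∀ a, N ≤ a → 0 ≤ f (a+1) - f a := by
    intro a ha
    by_contra hc
    push Not at hc
    have lin : ∀ k : ℕ, f (a+k) ≤ f a + k * (f (a+1) - f a) := by
      intro k
      induction k with
      | zero => simp
      | succ k ih =>
        have := anti a ha k
        rw [← add_assoc]
        push_cast
        linarith
    obtain ⟨k, hk⟩ := exists_nat_gt (f a / (-(f (a+1) - f a)))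
    rw [div_lt_iff₀ (by linarith)] at hk
    have := lin k
    have := hf (a+k)
    linarith
  have key : ∀ q : ℕ, ∀ a, N ≤ a → f (a+1) - f a ≤ q →
      ∃ M, N ≤ M ∧ ∀ n, M ≤ n → ¬ (f n + f (n+2) + 2 ≤ 2 * f (n+1)) := by
    intro q
    induction q with
    | zero =>
      intro a ha hq
      refine ⟨a, ha, fun n hn hc => ?_⟩
      obtain ⟨k, rfl⟩ := Nat.exists_eq_add_of_le hn
      have h1 := anti a ha k
      have h2 : 0 ≤ f (a+k+2) - f (a+k+1) := nn (a+k+1) (by omega)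
      push_cast at hq
      linarith
    | succ q ih =>
      intro a ha hq
      by_contra hno
      have hno' := hno
      push Not at hno
      obtain ⟨n, hn, hc⟩ := hno a ha
      obtain ⟨k, rfl⟩ := Nat.exists_eq_add_of_le hn
      have h1 := anti a ha k
      push_cast at hq
      refine hno' (ih (a+k+1) (by omega) ?_)
      have e : a + k + 1 + 1 = a + k + 2 := by ring
      rw [e]
      linarith
  obtain ⟨q, hq⟩ := exists_nat_ge (f (N+1) - f N)
  exact key q N le_rfl hq

lemma aux_conv (a b c : ENNReal) (ha : a ≠ ⊤) (hb : b ≠ ⊤) (hc : c ≠ ⊤) (t : ℕ)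
    (h : (1/2) * a + (1/2) * b + t ≤ c) : a.toReal + b.toReal + 2 * t ≤ 2 * c.toReal := by
  lift a to NNReal using ha
  lift b to NNReal using hb
  lift c to NNReal using hc
  have h2 : ((1/2 : NNReal) * a + (1/2) * b + t : NNReal) ≤ c := by
    rw [← ENNReal.coe_le_coe]
    push_cast
    simpa using h
  have h3 : ((1/2 : ℝ) * a + (1/2) * b + t : ℝ) ≤ c := by exact_mod_cast h2
  simp only [ENNReal.coe_toReal]
  linarith

/-- There is no lexicographic generalised Streett supermartingale for the symmetric
random walk on `ℤ` with the Streett pair `(ℤ ∖ {0}, {0})`: no `m ≥ 1` and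
`r : ℤ → [0,∞)^m` satisfy `½ r(x−1) + ½ r(x+1) ≺ r(x)` for all `x ≠ 0`. -/
theorem no_LexGSSM_for_symmetric_random_walk :
    ¬ ∃ (m : ℕ) (_ : 1 ≤ m) (r : ℤ → Fin m → ℝ≥0∞),
        (∀ x i, r x i ≠ ⊤) ∧
        ∀ x : ℤ, x ≠ 0 →
          lexGT (r x) (fun i => (1 / 2) * r (x - 1) i + (1 / 2) * r (x + 1) i) := by
  rintro ⟨m, hm, r, hfin, hr⟩
  obtain ⟨s, hs⟩ : ∃ s : ℕ → Fin m → ℝ, ∀ n i, s n i = (r (n : ℤ) i).toReal :=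
    ⟨_, fun _ _ => rfl⟩
  have hl : ∀ n : ℕ, ∃ l : Fin m, (∀ i < l, s n i + s (n+2) i ≤ 2 * s (n+1) i) ∧
      s n l + s (n+2) l + 2 ≤ 2 * s (n+1) l := by
    intro n
    obtain ⟨l, h1, h2⟩ := hr ((n : ℤ) + 1) (by omega)
    have e1 : (n : ℤ) + 1 - 1 = n := by ring
    have e2 : (n : ℤ) + 1 + 1 = n + 2 := by ring
    simp only [e1, e2] at h1 h2
    refine ⟨l, fun i hi => ?_, ?_⟩
    · have := aux_conv _ _ _ (hfin _ _) (hfin _ _) (hfin _ _) 0 (by simpa using h1 i hi)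
      simp only [hs]
      push_cast at this ⊢
      linarith
    · have := aux_conv _ _ _ (hfin _ _) (hfin _ _) (hfin _ _) 1 (by simpa using h2)
      simp only [hs]
      push_cast at this ⊢
      linarith
  choose L hL1 hL2 using hl
  have key : ∀ k : ℕ, k ≤ m → ∃ N, ∀ n, N ≤ n → k ≤ (L n : ℕ) := by
    intro k
    induction k with
    | zero => exact fun _ => ⟨0, fun _ _ => Nat.zero_le _⟩
    | succ k ih =>
      intro hk
      obtain ⟨N, hN⟩ := ih (by omega)
      obtain ⟨M, hM, hM2⟩ := aux_rw (fun n => s n ⟨k, hk⟩)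
        (fun n => by simp only [hs]; exact ENNReal.toReal_nonneg) N (by
          intro n hn
          rcases (hN n hn).lt_or_eq with h | h
          · exact hL1 n ⟨k, hk⟩ h
          · have e : L n = ⟨k, hk⟩ := Fin.ext h.symm
            have := hL2 n
            rw [e] at this
            linarith)
      refine ⟨M, fun n hn => ?_⟩
      rcases (hN n (hM.trans hn)).lt_or_eq with h | h
      · exact h
      · have e : L n = ⟨k, hk⟩ := Fin.ext h.symm
        have := hL2 n
        rw [e] at this
        exact absurd this (hM2 n hn)
  obtain ⟨N, hN⟩ := key m le_rfl
  have := hN N le_rfl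
  have := (L N).2
  omega
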